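/- There is a universal constant C > 0 with the following property. For every n ≥ 1, every h > 0, every finite set V ⊆ [0,h], every α ∈ (0,h], every β ∈ (0,α], and every γ ∈ (0,1), there exists a function A mapping every sequence of m value profiles in Vⁿ to a measurable DSIC and IR mechanism such that: for every product probability distribution D on Vⁿ with Opt(D) ≤ α, if m ≥ C·α·h·β^{−2}·(n·|V|·log(n·|V|) + log(h/(γβ))), then with probability at least 1−γ over m i.i.d. samples v₁,…,v_m from D, Rev(A(v₁,…,v_m), D) ≥ Opt(D) − β. -/

import Mathlib

open MeasureTheory

/-- A (direct-revelation) mechanism for `n` buyers and one item: an allocation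
rule and a payment rule on value profiles. -/
structure Mech (n : ℕ) where
  alloc : (Fin n → ℝ) → Fin n → ℝ
  pay : (Fin n → ℝ) → Fin n → ℝ

/-- Allocation probabilities are in `[0,1]` and sum to at most `1`. -/
def Mech.Valid {n : ℕ} (M : Mech n) : Prop :=
  ∀ v : Fin n → ℝ, (∀ i, 0 ≤ M.alloc v i ∧ M.alloc v i ≤ 1) ∧ ∑ i, M.alloc v i ≤ 1

/-- Dominant strategy incentive compatibility (on nonnegative value profiles). -/
def Mech.DSIC {n : ℕ} (M : Mech n) : Prop :=
  ∀ (i : Fin n) (v : Fin n → ℝ), (∀ j, 0 ≤ v j) → ∀ v' : ℝ, 0 ≤ v' →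
    v i * M.alloc (Function.update v i v') i - M.pay (Function.update v i v') i ≤
      v i * M.alloc v i - M.pay v i

/-- Individual rationality (on nonnegative value profiles). -/
def Mech.IR {n : ℕ} (M : Mech n) : Prop :=
  ∀ v : Fin n → ℝ, (∀ j, 0 ≤ v j) → ∀ i, 0 ≤ v i * M.alloc v i - M.pay v i

/-- Measurability of the allocation and payment rules. -/
def Mech.Meas {n : ℕ} (M : Mech n) : Prop :=
  (∀ i, Measurable fun v => M.alloc v i) ∧ (∀ i, Measurable fun v => M.pay v i)

/-- A measurable DSIC and IR mechanism. -/
def Mech.Good {n : ℕ} (M : Mech n) : Prop := M.Valid ∧ M.DSIC ∧ M.IR ∧ M.Meas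

/-- Expected revenue of mechanism `M` on value distribution `D`. -/
noncomputable def Rev {n : ℕ} (M : Mech n) (D : Measure (Fin n → ℝ)) : ℝ :=
  ∫ v, ∑ i, M.pay v i ∂D

/-- Optimal revenue: supremum of revenue over measurable DSIC and IR mechanisms. -/
noncomputable def Opt {n : ℕ} (D : Measure (Fin n → ℝ)) : ℝ :=
  sSup {r : ℝ | ∃ M : Mech n, M.Good ∧ r = Rev M D}

lemma vv_exists (f : ℝ → ℝ) (hf : ∀ s, 0 ≤ f s) (V : Finset ℝ) : ∃ c : ℝ → ℝ,
    (∀ x p : ℝ → ℝ, (∀ s ∈ V, ∀ t ∈ V, s * x t - p t ≤ s * x s - p s) →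
      (∀ s ∈ V, 0 ≤ s * x s - p s) → ∑ s ∈ V, f s * p s ≤ ∑ s ∈ V, c s * x s) ∧
    (∀ τ ∈ V, ∑ s ∈ V with τ ≤ s, c s = τ * ∑ s ∈ V with τ ≤ s, f s) ∧
    (∀ s ∈ V, c s ≤ f s * s) ∧
    (∀ b, (∀ s ∈ V, b ≤ s) → b * ∑ s ∈ V, f s ≤ ∑ s ∈ V, c s) := by
  induction V using Finset.induction_on_min with
  | empty => exact ⟨0, by simp⟩
  | insert a V ha ih =>
    obtain ⟨c, h1, h2, h3, h4⟩ := ih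
    have haV : a ∉ V := fun h => lt_irrefl _ (ha a h)
    have hT : 0 ≤ ∑ s ∈ V, f s := Finset.sum_nonneg fun s _ => hf s
    set c' : ℝ → ℝ := fun s => if s = a then a * (f a + ∑ s ∈ V, f s) - ∑ s ∈ V, c s else c s
      with hc'
    have hca : c' a = a * (f a + ∑ s ∈ V, f s) - ∑ s ∈ V, c s := by simp [hc']
    have hcV : ∀ s ∈ V, c' s = c s := fun s hs => by
      have : s ≠ a := fun h => haV (h ▸ hs)
      simp [hc', this]
    have hsum : ∀ g : ℝ → ℝ, ∑ s ∈ V, c' s * g s = ∑ s ∈ V, c s * g s := fun g =>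
      Finset.sum_congr rfl fun s hs => by rw [hcV s hs]
    have hsum1 : ∑ s ∈ V, c' s = ∑ s ∈ V, c s :=
      Finset.sum_congr rfl fun s hs => by rw [hcV s hs]
    refine ⟨c', ?_, ?_, ?_, ?_⟩
    · intro x p hd hi
      rw [Finset.sum_insert haV, Finset.sum_insert haV, hsum, hca]
      have key := h1 (fun s => x s - x a) (fun s => p s - p a)
        (fun s hs t ht => by
          have := hd s (Finset.mem_insert_of_mem hs) t (Finset.mem_insert_of_mem ht)
          linarith)
        (fun s hs => by
          have := hd s (Finset.mem_insert_of_mem hs) a (Finset.mem_insert_self _ _)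
          linarith)
      simp only [mul_sub, Finset.sum_sub_distrib, ← Finset.sum_mul] at key
      have hia := hi a (Finset.mem_insert_self _ _)
      have := mul_nonneg (add_nonneg (hf a) hT) hia
      nlinarith
    · intro τ hτ
      rcases Finset.mem_insert.1 hτ with rfl | hτ
      · have : (insert τ V).filter (fun s => τ ≤ s) = insert τ V := by
          apply Finset.filter_true_of_mem
          intro s hs
          rcases Finset.mem_insert.1 hs with rfl | hs
          · exact le_rfl
          · exact (ha s hs).le
        rw [this, Finset.sum_insert haV, Finset.sum_insert haV, hsum1, hca]
        ring
      · have : (insert a V).filter (fun s => τ ≤ s) = V.filter (fun s => τ ≤ s) := by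
          rw [Finset.filter_insert, if_neg (not_le.2 (ha τ hτ))]
        rw [this, ← h2 τ hτ]
        exact Finset.sum_congr rfl fun s hs => hcV s (Finset.mem_filter.1 hs).1
    · intro s hs
      rcases Finset.mem_insert.1 hs with rfl | hs
      · rw [hca]
        have := h4 s fun t ht => (ha t ht).le
        linarith
      · rw [hcV s hs]; exact h3 s hs
    · intro b hb
      rw [Finset.sum_insert haV, Finset.sum_insert haV, hsum1, hca]
      have := mul_le_mul_of_nonneg_right (hb a (Finset.mem_insert_self _ _))
        (add_nonneg (hf a) hT)
      linarith

/-- Ironed virtual values via isotonic regression. -/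
lemma iron_exists (f : ℝ → ℝ) (hf : ∀ s, 0 ≤ f s) (h : ℝ) (hh : 0 ≤ h) (V : Finset ℝ)
    (hV : ∀ s ∈ V, 0 ≤ s ∧ s ≤ h) : ∃ y : ℝ → ℝ,
    (∀ s ∈ V, 0 ≤ y s) ∧ (∀ s ∈ V, ∀ t ∈ V, s ≤ t → y s ≤ y t) ∧
    (∀ x p : ℝ → ℝ, (∀ s ∈ V, 0 ≤ x s) →
      (∀ s ∈ V, ∀ t ∈ V, s * x t - p t ≤ s * x s - p s) →
      (∀ s ∈ V, 0 ≤ s * x s - p s) → ∑ s ∈ V, f s * p s ≤ ∑ s ∈ V, f s * (y s * x s)) ∧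
    (∀ τ ∈ V, 0 < y τ → (∀ s ∈ V, s < τ → y s < y τ) →
      ∑ s ∈ V with τ ≤ s, f s * y s ≤ τ * ∑ s ∈ V with τ ≤ s, f s) := by
  obtain ⟨c, h1, h2, h3, -⟩ := vv_exists f hf V
  let P : Set (V → ℝ) := {y | Monotone y} ∩ Set.Icc 0 (fun _ => h)
  have hPc : IsCompact P := by
    apply IsCompact.inter_left isCompact_Icc
    have : {y : V → ℝ | Monotone y} = ⋂ a : V, ⋂ b : V, ⋂ _ : a ≤ b, {y | y a ≤ y b} := by
      ext y; simp [Monotone]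
    rw [this]
    refine isClosed_iInter fun a => isClosed_iInter fun b => isClosed_iInter fun _ =>
      isClosed_le (continuous_apply a) (continuous_apply b)
  let Q : (V → ℝ) → ℝ := fun y => ∑ s : V, (f s * y s ^ 2 - 2 * c s * y s)
  have hQ : Continuous Q := by fun_prop
  obtain ⟨y, hyP, hy⟩ := hPc.exists_isMinOn ⟨0, by
    refine ⟨fun a b _ => le_rfl, le_rfl, fun _ => hh⟩⟩ hQ.continuousOn
  have hmono : Monotone y := hyP.1
  have hy0 : ∀ s, 0 ≤ y s := fun s => hyP.2.1 s
  -- minimality over the cone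
  have hmin : ∀ z : V → ℝ, Monotone z → (∀ s, 0 ≤ z s) → Q y ≤ Q z := by
    intro z hz hz0
    have : Q y ≤ Q (fun s => min (z s) h) := hy ⟨fun a b hab => min_le_min_right _ (hz hab),
      fun s => le_min (hz0 s) hh, fun s => min_le_right _ _⟩
    refine this.trans (Finset.sum_le_sum fun s _ => ?_)
    show f s * (min (z s) h) ^ 2 - 2 * c s * min (z s) h ≤ _
    rcases le_total (z s) h with hzh | hzh
    · rw [min_eq_left hzh]
    · rw [min_eq_right hzh]
      have hc : c s ≤ f s * h := (h3 s s.2).trans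
        (mul_le_mul_of_nonneg_left (hV s s.2).2 (hf s))
      have e1 := mul_nonneg (sub_nonneg.2 hzh) (sub_nonneg.2 hc)
      have e2 := mul_nonneg (hf s) (sq_nonneg (z s - h))
      nlinarith
  have expand : ∀ (z : V → ℝ) (ε : ℝ), Q (fun s => y s + ε * z s) =
      Q y + ε * (2 * ∑ s : V, (f s * y s - c s) * z s) + ε ^ 2 * ∑ s : V, f s * z s ^ 2 := by
    intro z ε
    simp only [Q, Finset.mul_sum, ← Finset.sum_add_distrib]
    exact Finset.sum_congr rfl fun s _ => by ring
  -- variation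
  have var : ∀ (z : V → ℝ) (ε : ℝ), 0 < ε →
      (∀ δ, 0 < δ → δ ≤ ε → Monotone (fun s => y s + δ * z s) ∧ ∀ s, 0 ≤ y s + δ * z s) →
      0 ≤ ∑ s : V, (f s * y s - c s) * z s := by
    intro z ε hε hz
    by_contra hneg
    push Not at hneg
    set S := ∑ s : V, (f s * y s - c s) * z s
    set W := ∑ s : V, f s * z s ^ 2
    have hW : 0 ≤ W := Finset.sum_nonneg fun s _ => mul_nonneg (hf s) (sq_nonneg _)
    let δ := min ε (-S / (W + 1))
    have hδ : 0 < δ := lt_min hε (div_pos (by linarith) (by linarith))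
    obtain ⟨m1, m2⟩ := hz δ hδ (min_le_left _ _)
    have := hmin _ m1 m2
    rw [expand] at this
    have h5 : δ * (W + 1) ≤ -S := by
      have : δ ≤ -S / (W + 1) := min_le_right _ _
      rwa [le_div_iff₀ (by linarith)] at this
    have h6 : 0 ≤ δ * (2 * S + δ * W) := by linarith
    have h7 : 0 ≤ 2 * S + δ * W := nonneg_of_mul_nonneg_right h6 hδ
    nlinarith
  have sumV : ∀ g : ℝ → ℝ, ∑ s ∈ V, g s = ∑ s : V, g s := fun g => (Finset.sum_coe_sort V g).symm
  refine ⟨fun s => if hs : s ∈ V then y ⟨s, hs⟩ else 0, ?_, ?_, ?_, ?_⟩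
  · intro s hs; simp [hs, hy0]
  · intro s hs t ht hst; simp only [hs, ht, dif_pos]; exact hmono hst
  · intro x p hx hd hi
    refine (h1 x p hd hi).trans ?_
    have := var (fun s => x s) 1 one_pos (by
      intro δ hδ _
      refine ⟨fun a b hab => ?_, fun s => add_nonneg (hy0 s) (mul_nonneg hδ.le (hx s s.2))⟩
      have hab' : (a : ℝ) ≤ b := hab
      have hxx : x a ≤ x b := by
        rcases eq_or_lt_of_le hab' with e | e
        · rw [e]
        · have e1 := hd a a.2 b b.2
          have e2 := hd b b.2 a a.2
          by_contra hc
          push Not at hc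
          nlinarith
      exact add_le_add (hmono hab) (mul_le_mul_of_nonneg_left hxx hδ.le))
    rw [sumV, sumV, ← sub_nonneg, ← Finset.sum_sub_distrib]
    refine this.trans_eq (Finset.sum_congr rfl fun s _ => ?_)
    simp; ring
  · intro τ hτ hpos hlt
    rw [← h2 τ hτ]
    simp only [hτ, dif_pos] at hpos
    -- choose ε
    obtain ⟨ε, hε, hε1, hε2⟩ : ∃ ε : ℝ, 0 < ε ∧ ε ≤ y ⟨τ, hτ⟩ ∧
        ∀ s : V, (s : ℝ) < τ → y s + ε ≤ y ⟨τ, hτ⟩ := by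
      have : ∀ s : V, ∃ e : ℝ, 0 < e ∧ ((s : ℝ) < τ → y s + e ≤ y ⟨τ, hτ⟩) := by
        intro s
        by_cases hs : (s : ℝ) < τ
        · have := hlt s s.2 hs
          simp only [s.2, hτ, dif_pos] at this
          exact ⟨y ⟨τ, hτ⟩ - y s, by simpa using this, fun _ => by linarith⟩
        · exact ⟨1, one_pos, fun h => absurd h hs⟩
      choose e he he' using this
      have hne : (Finset.univ : Finset V).Nonempty := ⟨⟨τ, hτ⟩, Finset.mem_univ _⟩
      refine ⟨min (y ⟨τ, hτ⟩) (Finset.univ.inf' hne e), ?_, min_le_left _ _, ?_⟩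
      · exact lt_min hpos ((Finset.lt_inf'_iff _).2 fun s _ => he s)
      · intro s hs
        have : Finset.univ.inf' hne e ≤ e s := Finset.inf'_le _ (Finset.mem_univ s)
        have := he' s hs
        have := min_le_right (y ⟨τ, hτ⟩) (Finset.univ.inf' hne e)
        linarith
    have := var (fun s => if τ ≤ (s : ℝ) then -1 else 0) ε hε (by
      intro δ hδ hδε
      constructor
      · intro a b hab
        have hab' : (a : ℝ) ≤ b := hab
        have hm := hmono hab
        simp only
        split_ifs with ia ib ib
        · linarith
        · exact absurd (ia.trans hab') ib
        · have e1 := hε2 a (not_le.1 ia)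
          have e2 : y ⟨τ, hτ⟩ ≤ y b := hmono ib
          linarith
        · linarith
      · intro s
        split_ifs with is
        · have e2 : y ⟨τ, hτ⟩ ≤ y s := hmono is
          linarith
        · linarith [hy0 s])
    rw [Finset.sum_filter, Finset.sum_filter, sumV, sumV, ← sub_nonneg, ← Finset.sum_sub_distrib]
    refine this.trans_eq (Finset.sum_congr rfl fun s _ => ?_)
    simp only [s.2, dif_pos]
    split_ifs <;> ring

/-- `i` wins with ranks `ρ`. -/
def Win {n : ℕ} (ρ : Fin n → ℕ) (i : Fin n) : Prop :=
  0 < ρ i ∧ ∀ j, j ≠ i → ρ j < ρ i ∨ (ρ j = ρ i ∧ i < j)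

lemma Win.unique {n : ℕ} {ρ : Fin n → ℕ} {i j : Fin n} (hi : Win ρ i) (hj : Win ρ j) : i = j := by
  by_contra hne
  have h1 := hi.2 j (fun h => hne h.symm)
  have h2 := hj.2 i hne
  omega

lemma Win.exists {n : ℕ} {ρ : Fin n → ℕ} (j : Fin n) (hj : 0 < ρ j) :
    ∃ i, Win ρ i ∧ ∀ k, ρ k ≤ ρ i := by
  have hne : (Finset.univ : Finset (Fin n)).Nonempty := ⟨j, Finset.mem_univ _⟩
  obtain ⟨a, -, ha⟩ := Finset.exists_max_image Finset.univ ρ hne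
  have hne2 : (Finset.univ.filter fun b => ρ b = ρ a).Nonempty := ⟨a, by simp⟩
  obtain ⟨i, hi, him⟩ := Finset.exists_min_image _ id hne2
  simp only [Finset.mem_filter, Finset.mem_univ, true_and, id] at hi him
  have hmax : ∀ k, ρ k ≤ ρ i := fun k => hi ▸ ha k (Finset.mem_univ _)
  refine ⟨i, ⟨lt_of_lt_of_le hj (hmax j), fun k hk => ?_⟩, hmax⟩
  rcases lt_or_eq_of_le (hmax k) with h | h
  · exact Or.inl h
  · exact Or.inr ⟨h, lt_of_le_of_ne (him k (h.trans hi)) hk.symm⟩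

lemma Win.mono {n : ℕ} {ρ : Fin n → ℕ} {i : Fin n} {a b : ℕ} (hab : a ≤ b)
    (h : Win (Function.update ρ i a) i) : Win (Function.update ρ i b) i := by
  refine ⟨?_, fun j hj => ?_⟩
  · have := h.1; simp only [Function.update_self] at this ⊢; omega
  · have := h.2 j hj
    simp only [Function.update_self, Function.update_of_ne hj] at this ⊢; omega

/-- Rank of a value, rounding down to `V`. -/
noncomputable def rk {n : ℕ} (V : Finset ℝ) (φ : Fin n → V → ℕ) (i : Fin n) (t : ℝ) : ℕ :=
  (V.attach.filter (fun w : V => (w : ℝ) ≤ t)).sup (φ i)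

lemma rk_mono {n : ℕ} (V : Finset ℝ) (φ : Fin n → V → ℕ) (i : Fin n) : Monotone (rk V φ i) := by
  intro s t hst
  apply Finset.sup_mono
  intro w hw
  simp only [Finset.mem_filter] at hw ⊢
  exact ⟨hw.1, hw.2.trans hst⟩

lemma rk_attained {n : ℕ} (V : Finset ℝ) (φ : Fin n → V → ℕ) (i : Fin n) (t : ℝ)
    (ht : 0 < rk V φ i t) : ∃ w ∈ V, w ≤ t ∧ rk V φ i t ≤ rk V φ i w := by
  have hne : (V.attach.filter (fun w : V => (w : ℝ) ≤ t)).Nonempty := by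
    by_contra h
    rw [Finset.not_nonempty_iff_eq_empty] at h
    simp [rk, h] at ht
  obtain ⟨w, hw, hw2⟩ := Finset.exists_mem_eq_sup _ hne (φ i)
  simp only [Finset.mem_filter] at hw
  refine ⟨w, w.2, hw.2, ?_⟩
  rw [rk, hw2]
  exact Finset.le_sup (f := φ i) (by simp)

lemma rk_eq {n : ℕ} (V : Finset ℝ) (φ : Fin n → V → ℕ) (i : Fin n) (hφ : Monotone (φ i))
    (w : V) : rk V φ i w = φ i w := by
  apply le_antisymm
  · apply Finset.sup_le
    intro u hu
    simp only [Finset.mem_filter] at hu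
    exact hφ hu.2
  · exact Finset.le_sup (f := φ i) (by simp)

/-- values in `V` that win against the others -/
def winSet {n : ℕ} (V : Finset ℝ) (φ : Fin n → V → ℕ) (ρ : Fin n → ℕ) (i : Fin n) : Set ℝ :=
  {w | w ∈ V ∧ Win (Function.update ρ i (rk V φ i w)) i}

open Classical in
noncomputable def rankMech {n : ℕ} (V : Finset ℝ) (φ : Fin n → V → ℕ) : Mech n where
  alloc v i := if Win (fun j => rk V φ j (v j)) i then 1 else 0
  pay v i := if Win (fun j => rk V φ j (v j)) i then
    sInf (winSet V φ (fun j => rk V φ j (v j)) i) else 0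

lemma rk_update {n : ℕ} (V : Finset ℝ) (φ : Fin n → V → ℕ) (v : Fin n → ℝ) (i : Fin n) (t : ℝ) :
    (fun j => rk V φ j (Function.update v i t j)) =
      Function.update (fun j => rk V φ j (v j)) i (rk V φ i t) := by
  funext j
  by_cases hj : j = i
  · subst hj; simp
  · simp [hj]

lemma winSet_update {n : ℕ} (V : Finset ℝ) (φ : Fin n → V → ℕ) (ρ : Fin n → ℕ) (i : Fin n)
    (a : ℕ) : winSet V φ (Function.update ρ i a) i = winSet V φ ρ i := by
  simp [winSet]

/-- For fixed values of the others, the mechanism is a posted price. -/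
lemma posted {n : ℕ} (V : Finset ℝ) (φ : Fin n → V → ℕ) (v : Fin n → ℝ) (i : Fin n) :
    (∀ t, (rankMech V φ).alloc (Function.update v i t) i = 0 ∧
      (rankMech V φ).pay (Function.update v i t) i = 0) ∨
    ∃ τ ∈ V, (∀ t, (rankMech V φ).alloc (Function.update v i t) i = (if τ ≤ t then 1 else 0) ∧
      (rankMech V φ).pay (Function.update v i t) i = (if τ ≤ t then τ else 0)) ∧
      0 < rk V φ i τ ∧ ∀ s, s < τ → rk V φ i s < rk V φ i τ := by
  set ρ := fun j => rk V φ j (v j) with hρ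
  have key : ∀ t, Win (Function.update ρ i (rk V φ i t)) i →
      ∃ w ∈ winSet V φ ρ i, w ≤ t := by
    intro t ht
    have h0 := ht.1
    simp only [Function.update_self] at h0
    obtain ⟨w, hw, hwt, hr⟩ := rk_attained V φ i t h0
    exact ⟨w, ⟨hw, ht.mono hr⟩, hwt⟩
  have hfin : (winSet V φ ρ i).Finite := V.finite_toSet.subset fun w hw => hw.1
  rcases (winSet V φ ρ i).eq_empty_or_nonempty with he | hne
  · left
    intro t
    have : ¬ Win (fun j => rk V φ j (Function.update v i t j)) i := by
      rw [rk_update]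
      intro h
      obtain ⟨w, hw, -⟩ := key t h
      rw [he] at hw; exact hw
    simp [rankMech, this]
  · right
    have hmem := hne.csInf_mem hfin
    have hiff : ∀ t, Win (Function.update ρ i (rk V φ i t)) i ↔ sInf (winSet V φ ρ i) ≤ t := by
      intro t
      constructor
      · intro h
        obtain ⟨w, hw, hwt⟩ := key t h
        exact (csInf_le hfin.bddBelow hw).trans hwt
      · intro h
        exact hmem.2.mono (rk_mono V φ i h)
    refine ⟨sInf (winSet V φ ρ i), hmem.1, fun t => ?_, ?_, ?_⟩
    · have e1 : Win (fun j => rk V φ j (Function.update v i t j)) i ↔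
          sInf (winSet V φ ρ i) ≤ t := by rw [rk_update]; exact hiff t
      have e2 : winSet V φ (fun j => rk V φ j (Function.update v i t j)) i = winSet V φ ρ i := by
        rw [rk_update, winSet_update]
      simp only [rankMech, e1, e2]
      exact ⟨trivial, trivial⟩
    · simpa using hmem.2.1
    · intro s hs
      by_contra hc
      push Not at hc
      exact absurd ((hiff s).1 (hmem.2.mono hc)) (not_le.2 hs)

lemma posted' {n : ℕ} (V : Finset ℝ) (φ : Fin n → V → ℕ) (v : Fin n → ℝ) (i : Fin n) :
    ((rankMech V φ).alloc v i = 0 ∧ (rankMech V φ).pay v i = 0) ∨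
    ∃ τ ∈ V, τ ≤ v i ∧ (rankMech V φ).alloc v i = 1 ∧ (rankMech V φ).pay v i = τ := by
  rcases posted V φ v i with h | ⟨τ, hτ, h, -⟩
  · left; simpa using h (v i)
  · have := h (v i)
    simp only [Function.update_eq_self] at this
    by_cases hc : τ ≤ v i
    · right; exact ⟨τ, hτ, hc, by simpa [hc] using this⟩
    · left; simpa [hc] using this

lemma alloc_sum {n : ℕ} (V : Finset ℝ) (φ : Fin n → V → ℕ) (v : Fin n → ℝ) :
    ∑ i, (rankMech V φ).alloc v i ≤ 1 := by
  classical
  simp only [rankMech, Finset.sum_boole]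
  have : (Finset.univ.filter fun i => Win (fun j => rk V φ j (v j)) i).card ≤ 1 := by
    rw [Finset.card_le_one]
    intro a ha b hb
    simp only [Finset.mem_filter] at ha hb
    exact ha.2.unique hb.2
  exact_mod_cast this

lemma rankMech_good {n : ℕ} (V : Finset ℝ) (φ : Fin n → V → ℕ) : (rankMech V φ).Good := by
  classical
  refine ⟨fun v => ⟨fun i => ?_, alloc_sum V φ v⟩, ?_, ?_, ?_, ?_⟩
  · simp only [rankMech]; split_ifs <;> norm_num
  · intro i v _ t _
    rcases posted V φ v i with h | ⟨τ, hτ, h, -⟩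
    · have h1 := h t
      have h2 := h (v i)
      simp only [Function.update_eq_self] at h2
      rw [h1.1, h1.2, h2.1, h2.2]
    · have h1 := h t
      have h2 := h (v i)
      simp only [Function.update_eq_self] at h2
      rw [h1.1, h1.2, h2.1, h2.2]
      split_ifs <;> linarith
  · intro v _ i
    rcases posted' V φ v i with ⟨h1, h2⟩ | ⟨τ, _, h0, h1, h2⟩ <;> rw [h1, h2] <;> linarith
  all_goals
    intro i
    have hm : Measurable (fun v : Fin n → ℝ => fun j => rk V φ j (v j)) :=
      measurable_pi_lambda _ fun j => (rk_mono V φ j).measurable.comp (measurable_pi_apply j)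
  · exact (measurable_of_countable (fun ρ : Fin n → ℕ => if Win ρ i then (1 : ℝ) else 0)).comp hm
  · exact (measurable_of_countable (fun ρ : Fin n → ℕ => if Win ρ i then
      sInf (winSet V φ ρ i) else 0)).comp hm

lemma pay_bounds {n : ℕ} (V : Finset ℝ) (φ : Fin n → V → ℕ) (h : ℝ) (hh : 0 ≤ h)
    (hV : ∀ s ∈ V, 0 ≤ s ∧ s ≤ h) (v : Fin n → ℝ) :
    0 ≤ ∑ i, (rankMech V φ).pay v i ∧ ∑ i, (rankMech V φ).pay v i ≤ h := by
  constructor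
  · refine Finset.sum_nonneg fun i _ => ?_
    rcases posted' V φ v i with ⟨h1, h2⟩ | ⟨τ, hτ, h0, h1, h2⟩
    · rw [h2]
    · rw [h2]; exact (hV τ hτ).1
  · calc ∑ i, (rankMech V φ).pay v i ≤ ∑ i, h * (rankMech V φ).alloc v i := by
          refine Finset.sum_le_sum fun i _ => ?_
          rcases posted' V φ v i with ⟨h1, h2⟩ | ⟨τ, hτ, h0, h1, h2⟩
          · rw [h1, h2, mul_zero]
          · rw [h1, h2, mul_one]; exact (hV τ hτ).2
      _ = h * ∑ i, (rankMech V φ).alloc v i := by rw [Finset.mul_sum]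
      _ ≤ h * 1 := mul_le_mul_of_nonneg_left (alloc_sum V φ v) hh
      _ = h := mul_one h

/-- weight of a profile -/
noncomputable def wt {n : ℕ} (D : Fin n → Measure ℝ) (v : Fin n → ℝ) : ℝ :=
  ∏ i, (D i).real {v i}

lemma wt_nonneg {n : ℕ} (D : Fin n → Measure ℝ) (v : Fin n → ℝ) : 0 ≤ wt D v :=
  Finset.prod_nonneg fun _ _ => measureReal_nonneg

lemma integral_eq_sum {n : ℕ} (V : Finset ℝ) (D : Fin n → Measure ℝ)
    [∀ i, IsProbabilityMeasure (D i)] (hD : ∀ i, D i ((↑V : Set ℝ)ᶜ) = 0)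
    (g : (Fin n → ℝ) → ℝ) :
    ∫ v, g v ∂(Measure.pi D) = ∑ v ∈ Fintype.piFinset (fun _ : Fin n => V), wt D v * g v := by
  have hae : ∀ᵐ v ∂(Measure.pi D), v ∈ (↑(Fintype.piFinset (fun _ : Fin n => V)) : Set (Fin n → ℝ)) := by
    have : ∀ᵐ v ∂(Measure.pi D), ∀ i, v i ∈ (↑V : Set ℝ) := by
      rw [ae_all_iff]
      intro i
      have h1 : ∀ᵐ x ∂(D i), x ∈ (↑V : Set ℝ) := hD i
      exact (measurePreserving_eval D i).quasiMeasurePreserving.ae h1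
    filter_upwards [this] with v hv
    simpa [Fintype.mem_piFinset] using hv
  rw [← Measure.restrict_eq_self_of_ae_mem hae, setIntegral_finset _ IntegrableOn.finset]
  refine Finset.sum_congr rfl fun v _ => ?_
  simp [wt, measureReal_def, ENNReal.toReal_prod]

lemma sum_marginal (V : Finset ℝ) (D : Measure ℝ)
    [IsProbabilityMeasure D] (hD : D ((↑V : Set ℝ)ᶜ) = 0) : ∑ s ∈ V, D.real {s} = 1 := by
  have h1 : ∀ᵐ x ∂D, x ∈ (↑V : Set ℝ) := hD
  have h2 : ∫ _x, (1 : ℝ) ∂D = 1 := by simp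
  rw [← Measure.restrict_eq_self_of_ae_mem h1, setIntegral_finset _ IntegrableOn.finset] at h2
  simpa using h2

lemma wt_update {n : ℕ} (D : Fin n → Measure ℝ) (v : Fin n → ℝ) (i : Fin n) (s : ℝ) :
    wt D (Function.update v i s) * (D i).real {v i} = wt D v * (D i).real {s} := by
  unfold wt
  rw [← Finset.mul_prod_erase Finset.univ _ (Finset.mem_univ i),
    ← Finset.mul_prod_erase Finset.univ (fun j => (D j).real {v j}) (Finset.mem_univ i)]
  have : ∏ j ∈ Finset.univ.erase i, (D j).real {Function.update v i s j} =
      ∏ j ∈ Finset.univ.erase i, (D j).real {v j} :=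
    Finset.prod_congr rfl fun j hj => by
      rw [Function.update_of_ne (Finset.ne_of_mem_erase hj)]
  rw [this, Function.update_self]
  ring

lemma resample {n : ℕ} (V : Finset ℝ) (D : Fin n → Measure ℝ)
    [∀ i, IsProbabilityMeasure (D i)] (hD : ∀ i, D i ((↑V : Set ℝ)ᶜ) = 0) (i : Fin n)
    (g : (Fin n → ℝ) → ℝ) :
    ∑ v ∈ Fintype.piFinset (fun _ : Fin n => V), wt D v * g v =
    ∑ v ∈ Fintype.piFinset (fun _ : Fin n => V), wt D v *
      ∑ s ∈ V, (D i).real {s} * g (Function.update v i s) := by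
  set B := Fintype.piFinset (fun _ : Fin n => V) with hB
  have hup : ∀ v ∈ B, ∀ s ∈ V, Function.update v i s ∈ B := by
    intro v hv s hs
    rw [hB, Fintype.mem_piFinset] at hv ⊢
    intro j
    by_cases hj : j = i
    · subst hj; simpa using hs
    · rw [Function.update_of_ne hj]; exact hv j
  have e1 : ∑ v ∈ B, wt D v * g v = ∑ q ∈ B ×ˢ V, wt D q.1 * (D i).real {q.2} * g q.1 := by
    rw [Finset.sum_product]
    refine Finset.sum_congr rfl fun v _ => ?_
    simp only
    rw [← Finset.sum_mul, ← Finset.mul_sum, sum_marginal V (D i) (hD i), mul_one]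
  have e2 : ∑ v ∈ B, wt D v * ∑ s ∈ V, (D i).real {s} * g (Function.update v i s) =
      ∑ q ∈ B ×ˢ V, wt D q.1 * (D i).real {q.2} * g (Function.update q.1 i q.2) := by
    rw [Finset.sum_product]
    refine Finset.sum_congr rfl fun v _ => ?_
    rw [Finset.mul_sum]
    exact Finset.sum_congr rfl fun s _ => by ring
  rw [e1, e2]
  have hmaps : ∀ q ∈ B ×ˢ V, (Function.update q.1 i q.2, q.1 i) ∈ B ×ˢ V := by
    intro q hq
    rw [Finset.mem_product] at hq ⊢
    refine ⟨hup _ hq.1 _ hq.2, ?_⟩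
    have := hq.1
    rw [hB, Fintype.mem_piFinset] at this
    exact this i
  refine Finset.sum_nbij' (fun q => (Function.update q.1 i q.2, q.1 i))
    (fun q => (Function.update q.1 i q.2, q.1 i)) hmaps hmaps ?_ ?_ ?_
  · intro q _; simp
  · intro q _; simp
  · intro q _
    simp only [Function.update_idem, Function.update_eq_self]
    rw [wt_update]

lemma opt_in_class {n : ℕ} (V : Finset ℝ) (h : ℝ) (hh : 0 ≤ h) (hV : ∀ s ∈ V, 0 ≤ s ∧ s ≤ h)
    (D : Fin n → Measure ℝ)
    [∀ i, IsProbabilityMeasure (D i)] (hD : ∀ i, D i ((↑V : Set ℝ)ᶜ) = 0) :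
    ∃ φ : Fin n → V → Fin (n * V.card + 1), ∀ M : Mech n, M.Good →
      Rev M (Measure.pi D) ≤ Rev (rankMech V (fun i w => (φ i w : ℕ))) (Measure.pi D) := by
  classical
  have hy := fun i => iron_exists (fun s => (D i).real {s}) (fun s => measureReal_nonneg) h hh V hV
  choose y y0 ymono ya yb using hy
  let S : Fin n → V → Finset (Fin n × V) := fun i w =>
    Finset.univ.filter fun q => 0 < y q.1 q.2 ∧ y q.1 q.2 ≤ y i w
  have hS : ∀ i w, (S i w).card ≤ n * V.card := fun i w => by
    refine (Finset.card_le_univ _).trans ?_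
    simp
  let ψ : Fin n → V → ℕ := fun i w => (S i w).card
  have hψmono : ∀ (i : Fin n) (w : V) (j : Fin n) (u : V), y i w ≤ y j u → ψ i w ≤ ψ j u := by
    intro i w j u hle
    apply Finset.card_le_card
    intro q hq
    simp only [S, Finset.mem_filter] at hq ⊢
    exact ⟨hq.1, hq.2.1, hq.2.2.trans hle⟩
  have hψlt : ∀ (i : Fin n) (w : V) (j : Fin n) (u : V), y i w < y j u → ψ i w < ψ j u := by
    intro i w j u hlt
    apply Finset.card_lt_card
    rw [Finset.ssubset_iff_of_subset]
    · refine ⟨(j, u), ?_, ?_⟩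
      · simp only [S, Finset.mem_filter, Finset.mem_univ, true_and, le_refl, and_true]
        exact lt_of_le_of_lt (y0 i w w.2) hlt
      · simp [S, hlt]
    · intro q hq
      simp only [S, Finset.mem_filter] at hq ⊢
      exact ⟨hq.1, hq.2.1, hq.2.2.trans hlt.le⟩
  have hψpos : ∀ i w, 0 < ψ i w ↔ 0 < y i w := by
    intro i w
    constructor
    · intro hp
      obtain ⟨q, hq⟩ := Finset.card_pos.1 hp
      simp only [S, Finset.mem_filter] at hq
      exact hq.2.1.trans_le hq.2.2
    · intro hp
      exact Finset.card_pos.2 ⟨(i, w), by simp [S, hp]⟩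
  have hrk : ∀ i (w : V), rk V ψ i w = ψ i w := fun i w =>
    rk_eq V ψ i (fun a b hab => hψmono _ _ _ _ (ymono i a a.2 b b.2 hab)) w
  refine ⟨fun i w => ⟨ψ i w, Nat.lt_succ_of_le (hS i w)⟩, fun M hM => ?_⟩
  show Rev M (Measure.pi D) ≤ Rev (rankMech V ψ) (Measure.pi D)
  obtain ⟨hval, hds, hir, -⟩ := hM
  set B := Fintype.piFinset (fun _ : Fin n => V) with hB
  have memB : ∀ v ∈ B, ∀ j, v j ∈ V := fun v hv => by
    rw [hB, Fintype.mem_piFinset] at hv; exact hv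
  unfold Rev
  rw [integral_eq_sum V D hD, integral_eq_sum V D hD]
  -- upper bound for M
  have up : ∀ i, ∑ v ∈ B, wt D v * M.pay v i ≤ ∑ v ∈ B, wt D v * (y i (v i) * M.alloc v i) := by
    intro i
    rw [resample V D hD i (fun v => M.pay v i),
      resample V D hD i (fun v => y i (v i) * M.alloc v i)]
    refine Finset.sum_le_sum fun v hv => mul_le_mul_of_nonneg_left ?_ (wt_nonneg D v)
    have hnn : ∀ s ∈ V, ∀ j, 0 ≤ Function.update v i s j := by
      intro s hs j
      by_cases hj : j = i
      · subst hj; simpa using (hV s hs).1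
      · rw [Function.update_of_ne hj]; exact (hV _ (memB v hv j)).1
    have := ya i (fun s => M.alloc (Function.update v i s) i)
      (fun s => M.pay (Function.update v i s) i)
      (fun s _ => ((hval _).1 i).1)
      (fun s hs t ht => by
        have := hds i (Function.update v i s) (hnn s hs) t (hV t ht).1
        simpa using this)
      (fun s hs => by
        have := hir (Function.update v i s) (hnn s hs) i
        simpa using this)
    simpa using this
  -- lower bound for the rank mechanism
  have lo : ∀ i, ∑ v ∈ B, wt D v * (y i (v i) * (rankMech V ψ).alloc v i) ≤
      ∑ v ∈ B, wt D v * (rankMech V ψ).pay v i := by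
    intro i
    rw [resample V D hD i (fun v => (rankMech V ψ).pay v i),
      resample V D hD i (fun v => y i (v i) * (rankMech V ψ).alloc v i)]
    refine Finset.sum_le_sum fun v hv => mul_le_mul_of_nonneg_left ?_ (wt_nonneg D v)
    rcases posted V ψ v i with hp | ⟨τ, hτ, hp, hpos, hlt⟩
    · simp [hp]
    · have h1 : 0 < y i τ := by
        rw [hrk i ⟨τ, hτ⟩] at hpos
        exact (hψpos _ _).1 hpos
      have h2 : ∀ s ∈ V, s < τ → y i s < y i τ := by
        intro s hs hsτ
        have := hlt s hsτ
        rw [hrk i ⟨τ, hτ⟩, hrk i ⟨s, hs⟩] at this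
        by_contra hc
        push Not at hc
        exact absurd (hψmono i ⟨τ, hτ⟩ i ⟨s, hs⟩ hc) (not_le.2 this)
      have h3 := yb i τ hτ h1 h2
      rw [Finset.mul_sum, Finset.sum_filter, Finset.sum_filter] at h3
      refine le_trans (le_of_eq ?_) (h3.trans (le_of_eq ?_))
      · refine Finset.sum_congr rfl fun s _ => ?_
        rw [(hp s).1, Function.update_self]; split_ifs <;> ring
      · refine Finset.sum_congr rfl fun s _ => ?_
        rw [(hp s).2]; split_ifs <;> ring
  -- pointwise
  have pt : ∀ v ∈ B, ∑ i, y i (v i) * M.alloc v i ≤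
      ∑ i, y i (v i) * (rankMech V ψ).alloc v i := by
    intro v hv
    have hyn : ∀ i, 0 ≤ y i (v i) := fun i => y0 i _ (memB v hv i)
    have hr : ∀ j, rk V ψ j (v j) = ψ j ⟨v j, memB v hv j⟩ := fun j => hrk j ⟨v j, memB v hv j⟩
    have hann : ∀ i, 0 ≤ (rankMech V ψ).alloc v i := fun i => (((rankMech_good V ψ).1 v).1 i).1
    by_cases hz : ∃ j, 0 < y j (v j)
    · obtain ⟨j, hj⟩ := hz
      obtain ⟨i, hi, himax⟩ := Win.exists (ρ := fun j => rk V ψ j (v j)) j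
        (by rw [hr]; exact (hψpos _ _).2 hj)
      have hmax : ∀ k, y k (v k) ≤ y i (v i) := by
        intro k
        by_contra hc
        push Not at hc
        have h1 := hψlt i ⟨v i, memB v hv i⟩ k ⟨v k, memB v hv k⟩ hc
        have h2 := himax k
        rw [← hr, ← hr] at h1
        exact absurd h2 (not_le.2 h1)
      have hai : (rankMech V ψ).alloc v i = 1 := by simp [rankMech, hi]
      calc ∑ k, y k (v k) * M.alloc v k ≤ ∑ k, y i (v i) * M.alloc v k :=
            Finset.sum_le_sum fun k _ => mul_le_mul_of_nonneg_right (hmax k) ((hval v).1 k).1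
        _ = y i (v i) * ∑ k, M.alloc v k := by rw [Finset.mul_sum]
        _ ≤ y i (v i) * 1 := mul_le_mul_of_nonneg_left (hval v).2 (hyn i)
        _ = y i (v i) * (rankMech V ψ).alloc v i := by rw [hai]
        _ ≤ _ := Finset.single_le_sum (f := fun i => y i (v i) * (rankMech V ψ).alloc v i)
            (fun k _ => mul_nonneg (hyn k) (hann k)) (Finset.mem_univ i)
    · push Not at hz
      have : ∀ k, y k (v k) = 0 := fun k => le_antisymm (hz k) (hyn k)
      simp [this]
  calc ∑ v ∈ B, wt D v * ∑ i, M.pay v i = ∑ i, ∑ v ∈ B, wt D v * M.pay v i := by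
        rw [Finset.sum_comm]; simp only [Finset.mul_sum]
    _ ≤ ∑ i, ∑ v ∈ B, wt D v * (y i (v i) * M.alloc v i) := Finset.sum_le_sum fun i _ => up i
    _ = ∑ v ∈ B, wt D v * ∑ i, y i (v i) * M.alloc v i := by
        rw [Finset.sum_comm]; simp only [Finset.mul_sum]
    _ ≤ ∑ v ∈ B, wt D v * ∑ i, y i (v i) * (rankMech V ψ).alloc v i :=
        Finset.sum_le_sum fun v hv => mul_le_mul_of_nonneg_left (pt v hv) (wt_nonneg D v)
    _ = ∑ i, ∑ v ∈ B, wt D v * (y i (v i) * (rankMech V ψ).alloc v i) := by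
        rw [Finset.sum_comm]; simp only [Finset.mul_sum]
    _ ≤ ∑ i, ∑ v ∈ B, wt D v * (rankMech V ψ).pay v i := Finset.sum_le_sum fun i _ => lo i
    _ = ∑ v ∈ B, wt D v * ∑ i, (rankMech V ψ).pay v i := by
        rw [Finset.sum_comm]; simp only [Finset.mul_sum]

lemma chernoff {Ω : Type*} [MeasurableSpace Ω] (μ : Measure Ω) [IsProbabilityMeasure μ]
    (W : Ω → ℝ) (hW : Measurable W) (h α β e : ℝ) (hh : 0 < h) (hα : 0 < α) (hβ : 0 < β)
    (hβα : β ≤ α) (hb : ∀ ω, |W ω| ≤ h) (he : ∫ ω, W ω ∂μ = e)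
    (hv : ∫ ω, W ω ^ 2 ∂μ ≤ h * α) (m : ℕ) :
    (Measure.pi fun _ : Fin m => μ).real {s | m * (e + β / 2) ≤ ∑ t, W (s t)} ≤
      Real.exp (-(m * β ^ 2 / (16 * h * α))) := by
  set l : ℝ := β / (4 * h * α) with hl
  have hl0 : 0 < l := by positivity
  have hlh : l * h ≤ 1 := by
    have : l * h = β / (4 * α) := by rw [hl]; field_simp
    rw [this, div_le_one (by positivity)]; linarith
  have hint1 : Integrable W μ := Integrable.of_bound hW.aestronglyMeasurable h
    (Filter.Eventually.of_forall fun ω => by simpa using hb ω)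
  have hint2 : Integrable (fun ω => W ω ^ 2) μ :=
    Integrable.of_bound (hW.pow_const 2).aestronglyMeasurable (h ^ 2)
    (Filter.Eventually.of_forall fun ω => by
      have := hb ω
      rw [norm_pow, Real.norm_eq_abs]
      exact pow_le_pow_left₀ (abs_nonneg _) this 2)
  have hexp : ∀ ω, Real.exp (l * W ω) ≤ 1 + l * W ω + l ^ 2 * W ω ^ 2 := by
    intro ω
    have h1 : |l * W ω| ≤ 1 := by
      rw [abs_mul, abs_of_pos hl0]
      exact (mul_le_mul_of_nonneg_left (hb ω) hl0.le).trans hlh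
    have := (abs_le.1 (Real.abs_exp_sub_one_sub_id_le h1)).2
    nlinarith
  have hintE : Integrable (fun ω => Real.exp (l * W ω)) μ :=
    Integrable.of_bound (hW.const_mul l).exp.aestronglyMeasurable (Real.exp 1)
    (Filter.Eventually.of_forall fun ω => by
      rw [Real.norm_eq_abs, Real.abs_exp, Real.exp_le_exp]
      exact (mul_le_mul_of_nonneg_left ((le_abs_self _).trans (hb ω)) hl0.le).trans hlh)
  have hmgf : ∫ ω, Real.exp (l * W ω) ∂μ ≤ Real.exp (l * e + l ^ 2 * (h * α)) := by
    have i1 : Integrable (fun ω => 1 + l * W ω) μ := (integrable_const 1).add (hint1.const_mul l)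
    calc ∫ ω, Real.exp (l * W ω) ∂μ ≤ ∫ ω, (1 + l * W ω + l ^ 2 * W ω ^ 2) ∂μ :=
          integral_mono hintE (i1.add (hint2.const_mul _)) hexp
      _ = 1 + l * e + l ^ 2 * ∫ ω, W ω ^ 2 ∂μ := by
          rw [integral_add i1 (hint2.const_mul _), integral_add (integrable_const 1)
            (hint1.const_mul l), integral_const_mul, integral_const_mul, he]
          simp
      _ ≤ 1 + l * e + l ^ 2 * (h * α) := by
          have := mul_le_mul_of_nonneg_left hv (sq_nonneg l); linarith
      _ ≤ _ := by
          have := Real.add_one_le_exp (l * e + l ^ 2 * (h * α)); linarith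
  have hmeasX : Measurable (fun s : Fin m → Ω => ∑ t, W (s t)) :=
    Finset.measurable_sum _ fun t _ => hW.comp (measurable_pi_apply t)
  have hXb : ∀ s : Fin m → Ω, ∑ t, W (s t) ≤ m * h := by
    intro s
    calc ∑ t, W (s t) ≤ ∑ _t : Fin m, h :=
          Finset.sum_le_sum fun t _ => (le_abs_self _).trans (hb _)
      _ = m * h := by simp
  have main := ProbabilityTheory.measure_ge_le_exp_mul_mgf
    (μ := Measure.pi fun _ : Fin m => μ) (X := fun s : Fin m → Ω => ∑ t, W (s t))
    (t := l) (m * (e + β / 2)) hl0.le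
    (Integrable.of_bound (hmeasX.const_mul l).exp.aestronglyMeasurable (Real.exp (l * (m * h)))
      (Filter.Eventually.of_forall fun s => by
        rw [Real.norm_eq_abs, Real.abs_exp, Real.exp_le_exp]
        exact mul_le_mul_of_nonneg_left (hXb s) hl0.le))
  refine main.trans ?_
  have hm : ProbabilityTheory.mgf (fun s : Fin m → Ω => ∑ t, W (s t))
      (Measure.pi fun _ : Fin m => μ) l ≤ Real.exp (m * (l * e + l ^ 2 * (h * α))) := by
    unfold ProbabilityTheory.mgf
    simp only [Finset.mul_sum, Real.exp_sum]
    rw [integral_fintype_prod_eq_pow (fun ω => Real.exp (l * W ω)), Fintype.card_fin,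
      Real.exp_nat_mul]
    exact pow_le_pow_left₀ (integral_nonneg fun ω => (Real.exp_pos _).le) hmgf m
  refine (mul_le_mul_of_nonneg_left hm (Real.exp_pos _).le).trans ?_
  rw [← Real.exp_add, Real.exp_le_exp]
  apply le_of_eq
  rw [hl]; field_simp; ring

lemma count_bound (K : ℕ) (hK : 2 ≤ K) : ((K : ℝ) + 1) ^ K + 1 ≤ Real.exp (3 * (K * Real.log K)) := by
  have hK0 : (0 : ℝ) < K := by positivity
  have hK2 : (2 : ℝ) ≤ K := by exact_mod_cast hK
  have : Real.exp (3 * (K * Real.log K)) = (K : ℝ) ^ (3 * K) := by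
    rw [← Real.exp_log (pow_pos hK0 (3 * K)), Real.log_pow]
    congr 1; push_cast; ring
  rw [this]
  have e1 : ((K : ℝ) + 1) ^ K ≤ (K ^ 2) ^ K := pow_le_pow_left₀ (by positivity) (by nlinarith) K
  have e2 : (K : ℝ) ^ (3 * K) = (K ^ 2) ^ K * K ^ K := by rw [← pow_mul, ← pow_add]; congr 1; ring
  have e3 : (2 : ℝ) ≤ (K : ℝ) ^ K := hK2.trans (le_self_pow₀ (by linarith) (by omega))
  have e4 : (1 : ℝ) ≤ (K ^ 2) ^ K := one_le_pow₀ (by nlinarith)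
  rw [e2]; nlinarith

/-- **Sample complexity for finite-support product distributions.**
There is a universal constant `C > 0` such that for all `n ≥ 1`, `h > 0`,
finite `V ⊆ [0,h]`, `α ∈ (0,h]`, `β ∈ (0,α]`, `γ ∈ (0,1)`, there is a learning
rule `A` from samples to measurable DSIC and IR mechanisms such that for every
product distribution `D` on `Vⁿ` with `Opt(D) ≤ α`, whenever
`m ≥ C·α·h·β⁻²·(n·|V|·log(n·|V|) + log(h/(γβ)))`, with probability at least
`1-γ` over `m` i.i.d. samples from `D` the learned mechanism has revenue at
least `Opt(D) - β`. -/
theorem finite_support_sample_complexity :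
    ∃ C : ℝ, 0 < C ∧
      ∀ (n : ℕ), 1 ≤ n → ∀ h : ℝ, 0 < h →
      ∀ V : Finset ℝ, (∀ x ∈ V, x ∈ Set.Icc (0 : ℝ) h) →
      ∀ α β γ : ℝ, α ∈ Set.Ioc (0 : ℝ) h → β ∈ Set.Ioc (0 : ℝ) α →
        γ ∈ Set.Ioo (0 : ℝ) 1 →
      ∃ A : (m : ℕ) → (Fin m → (Fin n → ℝ)) → Mech n,
        (∀ m s, (A m s).Good) ∧
        ∀ D : Fin n → Measure ℝ, (∀ i, IsProbabilityMeasure (D i)) →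
          (∀ i, D i ((↑V : Set ℝ)ᶜ) = 0) →
          Opt (Measure.pi D) ≤ α →
          ∀ m : ℕ,
            C * α * h / β ^ 2 *
                ((n : ℝ) * V.card * Real.log ((n : ℝ) * V.card)
                  + Real.log (h / (γ * β))) ≤ (m : ℝ) →
            ENNReal.ofReal (1 - γ) ≤
              (Measure.pi fun _ : Fin m => Measure.pi D)
                {s | Opt (Measure.pi D) - β ≤ Rev (A m s) (Measure.pi D)} := by
  classical
  refine ⟨48, by norm_num, ?_⟩
  intro n hn h hh V hV α β γ hα hβ hγ
  have hV' : ∀ s ∈ V, 0 ≤ s ∧ s ≤ h := hV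
  have bdd : ∀ (D : Fin n → Measure ℝ) (φ : Fin n → V → Fin (n * V.card + 1)),
      (∀ M : Mech n, M.Good →
        Rev M (Measure.pi D) ≤ Rev (rankMech V (fun i w => (φ i w : ℕ))) (Measure.pi D)) →
      Opt (Measure.pi D) ≤ Rev (rankMech V (fun i w => (φ i w : ℕ))) (Measure.pi D) ∧
      ∀ M : Mech n, M.Good → Rev M (Measure.pi D) ≤ Opt (Measure.pi D) := by
    intro D φ hφ
    refine ⟨csSup_le ⟨_, _, rankMech_good V (fun _ _ => 0), rfl⟩ ?_, fun M hM => le_csSup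
      ⟨Rev (rankMech V (fun i w => (φ i w : ℕ))) (Measure.pi D), ?_⟩ ⟨M, hM, rfl⟩⟩
    · rintro r ⟨M, hM, rfl⟩; exact hφ M hM
    · rintro r ⟨M, hM, rfl⟩; exact hφ M hM
  by_cases hk : V.card ≤ 1
  · by_cases hex : ∃ D : Fin n → Measure ℝ, (∀ i, IsProbabilityMeasure (D i)) ∧
        (∀ i, D i ((↑V : Set ℝ)ᶜ) = 0)
    · obtain ⟨D0, hp0, hs0⟩ := hex
      obtain ⟨φ, hφ⟩ := opt_in_class V h hh.le hV' D0 hs0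
      refine ⟨fun _ _ => rankMech V (fun i w => (φ i w : ℕ)), fun _ _ => rankMech_good V _, ?_⟩
      intro D hp hs _ m _
      have huniq : ∀ E : Measure ℝ, IsProbabilityMeasure E → E ((↑V : Set ℝ)ᶜ) = 0 →
          ∀ E' : Measure ℝ, IsProbabilityMeasure E' → E' ((↑V : Set ℝ)ᶜ) = 0 → E = E' := by
        intro E hE hE0 E' hE' hE0'
        have h1 := sum_marginal V E hE0
        have h2 := sum_marginal V E' hE0'
        rw [Measure.ae_mem_finset_iff.1 (show ∀ᵐ a ∂E, a ∈ V from hE0),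
          Measure.ae_mem_finset_iff.1 (show ∀ᵐ a ∂E', a ∈ V from hE0')]
        refine Finset.sum_congr rfl fun a ha => ?_
        have hVa : V = {a} := by
          apply Finset.eq_singleton_iff_unique_mem.2
          exact ⟨ha, fun b hb => Finset.card_le_one.1 hk b hb a ha⟩
        rw [hVa, Finset.sum_singleton] at h1 h2
        congr 1
        rw [← ENNReal.toReal_eq_toReal_iff' (measure_ne_top _ _) (measure_ne_top _ _)]
        exact h1.trans h2.symm
      have hDD : D = D0 := funext fun i => huniq _ (hp i) (hs i) _ (hp0 i) (hs0 i)
      subst hDD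
      have hle := (bdd D φ hφ).1
      have : {s : Fin m → Fin n → ℝ | Opt (Measure.pi D) - β ≤
          Rev (rankMech V (fun i w => (φ i w : ℕ))) (Measure.pi D)} = Set.univ := by
        ext s; simp only [Set.mem_ofPred_eq, Set.mem_univ, iff_true]; linarith [hβ.1]
      rw [this, measure_univ]
      exact ENNReal.ofReal_le_one.2 (by linarith [hγ.1])
    · exact ⟨fun _ _ => rankMech V (fun _ _ => 0), fun _ _ => rankMech_good V _,
        fun D hp hs => absurd ⟨D, hp, hs⟩ hex⟩
  · push Not at hk
    let Φ := Fin n → V → Fin (n * V.card + 1)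
    let Mφ : Φ → Mech n := fun φ => rankMech V (fun i w => (φ i w : ℕ))
    let Z : Φ → (Fin n → ℝ) → ℝ := fun φ v => ∑ i, (Mφ φ).pay v i
    have hZm : ∀ φ, Measurable (Z φ) := fun φ =>
      Finset.measurable_sum _ fun i _ => (rankMech_good V _).2.2.2.2 i
    have hZb : ∀ φ v, 0 ≤ Z φ v ∧ Z φ v ≤ h := fun φ v => pay_bounds V _ h hh.le hV' v
    have hmax : ∀ (m : ℕ) (s : Fin m → Fin n → ℝ), ∃ φ : Φ, ∀ φ', ∑ t, Z φ' (s t) ≤ ∑ t, Z φ (s t) :=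
      fun m s => Finite.exists_max (fun φ : Φ => ∑ t, Z φ (s t))
    choose erm herm using hmax
    refine ⟨fun m s => Mφ (erm m s), fun m s => rankMech_good V _, ?_⟩
    intro D hp hs hopt m hm
    obtain ⟨φs, hφs⟩ := opt_in_class V h hh.le hV' D hs
    obtain ⟨b1, b2⟩ := bdd D φs hφs
    set μ := Measure.pi D with hμ
    set P := Measure.pi (fun _ : Fin m => μ) with hP
    have hα0 := hα.1
    have hβ0 := hβ.1
    set q := Real.exp (-(m * β ^ 2 / (16 * h * α))) with hq
    have hRev : ∀ φ, ∫ v, Z φ v ∂μ = Rev (Mφ φ) μ := fun φ => rfl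
    have hsq : ∀ φ, ∫ v, Z φ v ^ 2 ∂μ ≤ h * α := by
      intro φ
      have i1 : Integrable (Z φ) μ := Integrable.of_bound (hZm φ).aestronglyMeasurable h
        (Filter.Eventually.of_forall fun v => by
          rw [Real.norm_eq_abs, abs_of_nonneg (hZb φ v).1]; exact (hZb φ v).2)
      calc ∫ v, Z φ v ^ 2 ∂μ ≤ ∫ v, h * Z φ v ∂μ := by
            refine integral_mono_of_nonneg (Filter.Eventually.of_forall fun v => sq_nonneg _)
              (i1.const_mul h) (Filter.Eventually.of_forall fun v => ?_)
            have := hZb φ v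
            show Z φ v ^ 2 ≤ h * Z φ v
            nlinarith
        _ = h * Rev (Mφ φ) μ := by rw [integral_const_mul, hRev]
        _ ≤ h * α := mul_le_mul_of_nonneg_left ((b2 _ (rankMech_good V _)).trans hopt) hh.le
    let Bu : Φ → Set (Fin m → Fin n → ℝ) := fun φ =>
      {s | m * (Rev (Mφ φ) μ + β / 2) ≤ ∑ t, Z φ (s t)}
    let Bl : Set (Fin m → Fin n → ℝ) :=
      {s | m * (-Rev (Mφ φs) μ + β / 2) ≤ ∑ t, -Z φs (s t)}
    have hBu : ∀ φ, P.real (Bu φ) ≤ q := fun φ =>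
      chernoff μ (Z φ) (hZm φ) h α β _ hh hα0 hβ0 hβ.2
        (fun v => by rw [abs_of_nonneg (hZb φ v).1]; exact (hZb φ v).2) (hRev φ) (hsq φ) m
    have hBl : P.real Bl ≤ q :=
      chernoff μ (fun v => -Z φs v) (hZm φs).neg h α β _ hh hα0 hβ0 hβ.2
        (fun v => by rw [abs_neg, abs_of_nonneg (hZb φs v).1]; exact (hZb φs v).2)
        (by rw [integral_neg, hRev]) (by simpa using hsq φs) m
    have hBum : ∀ φ, MeasurableSet (Bu φ) := fun φ =>
      measurableSet_le measurable_const
        (Finset.measurable_sum _ fun t _ => (hZm φ).comp (measurable_pi_apply t))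
    have hBlm : MeasurableSet Bl :=
      measurableSet_le measurable_const
        (Finset.measurable_sum _ fun t _ => ((hZm φs).comp (measurable_pi_apply t)).neg)
    let Bad := Bl ∪ ⋃ φ, Bu φ
    have hBadm : MeasurableSet Bad := hBlm.union (MeasurableSet.iUnion hBum)
    have hBad : P.real Bad ≤ γ := by
      have hcard : (Fintype.card Φ : ℝ) = (((n * V.card : ℕ) : ℝ) + 1) ^ (n * V.card) := by
        have : Fintype.card Φ = (n * V.card + 1) ^ (n * V.card) := by
          simp only [Φ, Fintype.card_fun, Fintype.card_fin, Fintype.card_coe]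
          rw [← pow_mul, mul_comm V.card n]
        rw [this]; push_cast; ring
      have h1 : P.real Bad ≤ q + Fintype.card Φ * q := by
        refine (measureReal_union_le _ _).trans (add_le_add hBl ?_)
        refine (measureReal_iUnion_fintype_le _).trans ?_
        refine (Finset.sum_le_sum fun φ _ => hBu φ).trans ?_
        simp
      refine h1.trans ?_
      have hK : 2 ≤ n * V.card := by nlinarith
      have hcb := count_bound (n * V.card) hK
      rw [← hcard] at hcb
      set K : ℕ := n * V.card with hKdef
      have hKr : (n : ℝ) * V.card = (K : ℝ) := by rw [hKdef]; push_cast; ring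
      rw [hKr] at hm
      have hlog : Real.log (1 / γ) ≤ Real.log (h / (γ * β)) := by
        apply Real.log_le_log (by have := hγ.1; positivity)
        rw [div_le_div_iff₀ hγ.1 (mul_pos hγ.1 hβ0)]
        have : γ * β ≤ γ * h := mul_le_mul_of_nonneg_left (hβ.2.trans hα.2) hγ.1.le
        linarith
      have hlog1 : 0 ≤ Real.log (1 / γ) := by
        apply Real.log_nonneg; rw [le_div_iff₀ hγ.1]; linarith [hγ.2]
      have hqb : q ≤ Real.exp (-(3 * (K * Real.log K)) - Real.log (1 / γ)) := by
        rw [hq, Real.exp_le_exp]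
        have e1 : 48 * α * h / β ^ 2 * (K * Real.log K + Real.log (h / (γ * β))) *
            (β ^ 2 / (16 * h * α)) = 3 * (K * Real.log K + Real.log (h / (γ * β))) := by
          field_simp; ring
        have e2 := mul_le_mul_of_nonneg_right hm
          (show 0 ≤ β ^ 2 / (16 * h * α) by positivity)
        rw [e1, ← mul_div_assoc] at e2
        linarith
      calc q + Fintype.card Φ * q = (Fintype.card Φ + 1) * q := by ring
        _ ≤ Real.exp (3 * (K * Real.log K)) *
            Real.exp (-(3 * (K * Real.log K)) - Real.log (1 / γ)) :=
            mul_le_mul hcb hqb (Real.exp_pos _).le (Real.exp_pos _).le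
        _ = γ := by
            rw [← Real.exp_add, one_div, Real.log_inv]
            ring_nf
            exact Real.exp_log hγ.1
    have hsub : Badᶜ ⊆ {s | Opt μ - β ≤ Rev (Mφ (erm m s)) μ} := by
      intro s hsB
      simp only [Bad, Set.mem_compl_iff, Set.mem_union, Set.mem_iUnion, not_or, not_exists] at hsB
      obtain ⟨n1, n2⟩ := hsB
      have n3 := n2 (erm m s)
      simp only [Bl, Bu, Set.mem_ofPred_eq, not_le, Finset.sum_neg_distrib] at n1 n3
      have n4 := herm m s φs
      show Opt μ - β ≤ Rev (Mφ (erm m s)) μ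
      have b1' : Opt μ ≤ Rev (Mφ φs) μ := b1
      have n5 : (m : ℝ) * (Rev (Mφ φs) μ - β) < m * Rev (Mφ (erm m s)) μ := by linarith
      have := lt_of_mul_lt_mul_left n5 (Nat.cast_nonneg m)
      linarith
    refine le_trans ?_ (measure_mono hsub)
    have hc : P.real Badᶜ = 1 - P.real Bad := probReal_compl_eq_one_sub hBadm
    rw [← ofReal_measureReal]
    exact ENNReal.ofReal_le_ofReal (by rw [hc]; linarith)
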